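/- The monoid M presented by generators x0, y0, z0, a1, x1, y1, z1, a2, x2, y2, z2, ... and relations x0 + y0 = x0 + z0, y_l = y_{l+1} + a_{l+1}, z_l = z_{l+1} + a_{l+1}, and x_l = x_{l+1} + y_{l+1} = x_{l+1} + z_{l+1} for all l ≥ 0, is a refinement monoid. -/

import Mathlib

/-- A commutative monoid satisfies the Riesz refinement property if every equation
`x1 + x2 = y1 + y2` admits a refinement matrix. -/
def IsRefinementAddMonoid (M : Type*) [AddCommMonoid M] : Prop :=
  ∀ x1 x2 y1 y2 : M, x1 + x2 = y1 + y2 →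
    ∃ z11 z12 z21 z22 : M,
      x1 = z11 + z12 ∧ x2 = z21 + z22 ∧ y1 = z11 + z21 ∧ y2 = z12 + z22

/-- The algebraic (minimal) ordering on a commutative monoid: `x ≤ y` iff `x + z = y`
for some `z`. -/
def AlgLE {M : Type*} [AddCommMonoid M] (x y : M) : Prop := ∃ z, x + z = y

/-- Generators of the free commutative monoid underlying the monoid `M` of Section 4:
`Sum.inl (0, l)`, `Sum.inl (1, l)`, `Sum.inl (2, l)` are `x_l`, `y_l`, `z_l` (for `l ≥ 0`),
and `Sum.inr l` is `a_{l+1}` (for `l ≥ 0`). -/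
abbrev FreeGenM : Type := (Fin 3 × ℕ) ⊕ ℕ

/-- The free commutative monoid on the generators. -/
abbrev FreeMonM : Type := FreeGenM →₀ ℕ

/-- The generator `x_l`. -/
noncomputable def Xg (l : ℕ) : FreeMonM := Finsupp.single (Sum.inl (0, l)) 1
/-- The generator `y_l`. -/
noncomputable def Yg (l : ℕ) : FreeMonM := Finsupp.single (Sum.inl (1, l)) 1
/-- The generator `z_l`. -/
noncomputable def Zg (l : ℕ) : FreeMonM := Finsupp.single (Sum.inl (2, l)) 1
/-- The generator `a_{l+1}` (so `Ag 0 = a_1`, `Ag 1 = a_2`, ...). -/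
noncomputable def Ag (l : ℕ) : FreeMonM := Finsupp.single (Sum.inr l) 1

/-- The defining relations: `x0 + y0 = x0 + z0`, `y_l = y_{l+1} + a_{l+1}`,
`z_l = z_{l+1} + a_{l+1}`, `x_l = x_{l+1} + y_{l+1}`, `x_l = x_{l+1} + z_{l+1}`. -/
def MRel : FreeMonM → FreeMonM → Prop := fun u v =>
  (u = Xg 0 + Yg 0 ∧ v = Xg 0 + Zg 0) ∨
  (∃ l, u = Yg l ∧ v = Yg (l + 1) + Ag l) ∨
  (∃ l, u = Zg l ∧ v = Zg (l + 1) + Ag l) ∨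
  (∃ l, u = Xg l ∧ v = Xg (l + 1) + Yg (l + 1)) ∨
  (∃ l, u = Xg l ∧ v = Xg (l + 1) + Zg (l + 1))

/-- The smallest congruence containing the defining relations. -/
noncomputable def MCon : AddCon FreeMonM := addConGen MRel

/-- The monoid `M` of Section 4 of the paper. -/
abbrev MonM : Type := MCon.Quotient

/-- The image of `x_l` in `M`. -/
noncomputable def xq (l : ℕ) : MonM := MCon.mk' (Xg l)
/-- The image of `y_l` in `M`. -/
noncomputable def yq (l : ℕ) : MonM := MCon.mk' (Yg l)
/-- The image of `z_l` in `M`. -/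
noncomputable def zq (l : ℕ) : MonM := MCon.mk' (Zg l)
/-- The image of `a_{l+1}` in `M`. -/
noncomputable def aq (l : ℕ) : MonM := MCon.mk' (Ag l)

/-- Universal property of `MonM`. -/
theorem MonM_lift {A : Type*} [AddCommMonoid A] (gx gy gz ga : ℕ → A)
    (h0 : gx 0 + gy 0 = gx 0 + gz 0)
    (hy : ∀ l, gy l = gy (l + 1) + ga l)
    (hz : ∀ l, gz l = gz (l + 1) + ga l)
    (hxy : ∀ l, gx l = gx (l + 1) + gy (l + 1))
    (hxz : ∀ l, gx l = gx (l + 1) + gz (l + 1)) :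
    ∃ F : MonM →+ A, (∀ l, F (xq l) = gx l) ∧ (∀ l, F (yq l) = gy l) ∧
      (∀ l, F (zq l) = gz l) ∧ (∀ l, F (aq l) = ga l) := by
  let g : FreeGenM → A := fun s => Sum.elim (fun p : Fin 3 × ℕ => ![gx p.2, gy p.2, gz p.2] p.1) ga s
  let G : FreeMonM →+ A := Finsupp.liftAddHom (fun s => (multiplesHom A) (g s))
  have GX : ∀ l, G (Xg l) = gx l := fun l => by simp [G, Xg, g]
  have GY : ∀ l, G (Yg l) = gy l := fun l => by simp [G, Yg, g]
  have GZ : ∀ l, G (Zg l) = gz l := fun l => by simp [G, Zg, g]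
  have GA : ∀ l, G (Ag l) = ga l := fun l => by simp [G, Ag, g]
  have hle : MCon ≤ AddCon.ker G := by
    unfold MCon
    rw [AddCon.addConGen_le]
    intro u v h
    rw [AddCon.ker_rel]
    rcases h with ⟨rfl, rfl⟩ | ⟨l, rfl, rfl⟩ | ⟨l, rfl, rfl⟩ | ⟨l, rfl, rfl⟩ | ⟨l, rfl, rfl⟩
    · simpa [map_add, GX, GY, GZ, GA] using h0
    · simpa [map_add, GX, GY, GZ, GA] using hy l
    · simpa [map_add, GX, GY, GZ, GA] using hz l
    · simpa [map_add, GX, GY, GZ, GA] using hxy l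
    · simpa [map_add, GX, GY, GZ, GA] using hxz l
  exact ⟨MCon.lift G hle, fun l => GX l, fun l => GY l, fun l => GZ l, fun l => GA l⟩

theorem MRel_eq {u v : FreeMonM} (h : MRel u v) : MCon.mk' u = MCon.mk' v :=
  (AddCon.eq MCon).2 (AddConGen.Rel.of _ _ h)

theorem yq_succ (l : ℕ) : yq l = yq (l + 1) + aq l := by
  have := MRel_eq (Or.inr (Or.inl ⟨l, rfl, rfl⟩))
  simpa only [map_add, xq, yq, zq, aq] using this

theorem zq_succ (l : ℕ) : zq l = zq (l + 1) + aq l := by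
  have := MRel_eq (Or.inr (Or.inr (Or.inl ⟨l, rfl, rfl⟩)))
  simpa only [map_add, xq, yq, zq, aq] using this

theorem xq_succ_y (l : ℕ) : xq l = xq (l + 1) + yq (l + 1) := by
  have := MRel_eq (Or.inr (Or.inr (Or.inr (Or.inl ⟨l, rfl, rfl⟩))))
  simpa only [map_add, xq, yq, zq, aq] using this

theorem xq_succ_z (l : ℕ) : xq l = xq (l + 1) + zq (l + 1) := by
  have := MRel_eq (Or.inr (Or.inr (Or.inr (Or.inr ⟨l, rfl, rfl⟩))))
  simpa only [map_add, xq, yq, zq, aq] using this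

theorem xq_yz (l : ℕ) : xq l + yq l = xq l + zq l := by
  cases l with
  | zero =>
    have := MRel_eq (Or.inl ⟨rfl, rfl⟩)
    simpa only [map_add, xq, yq, zq, aq] using this
  | succ l => rw [← xq_succ_y, ← xq_succ_z]

/-- The map from the free monoid on the `a_l`. -/
noncomputable def aSum : (ℕ →₀ ℕ) →+ MonM :=
  Finsupp.liftAddHom (fun s => (multiplesHom MonM) (aq s))

theorem aSum_single (l m : ℕ) : aSum (Finsupp.single l m) = m • aq l := by
  simp [aSum]

/-- Evaluation of a level `n` word. -/
noncomputable def levelE (n i j k : ℕ) (f : ℕ →₀ ℕ) : MonM :=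
  i • xq n + j • yq n + k • zq n + aSum f

theorem levelE_add (n i j k i' j' k' : ℕ) (f f' : ℕ →₀ ℕ) :
    levelE n (i + i') (j + j') (k + k') (f + f') = levelE n i j k f + levelE n i' j' k' f' := by
  simp only [levelE, add_nsmul, map_add]
  abel

theorem levelE_succ (n i j k : ℕ) (f : ℕ →₀ ℕ) :
    levelE n i j k f = levelE (n + 1) i (j + i) k (f + Finsupp.single n (j + k)) := by
  simp only [levelE, add_nsmul, map_add, aSum_single]
  conv_lhs => rw [yq_succ n, zq_succ n, xq_succ_y n]
  simp only [nsmul_add]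
  abel

theorem levelE_shift (n t i j k : ℕ) (f : ℕ →₀ ℕ) :
    ∃ f', levelE n i j k f = levelE (n + t) i (j + t * i) k f' := by
  induction t with
  | zero => exact ⟨f, by simp⟩
  | succ t ih =>
    obtain ⟨f', h⟩ := ih
    rw [levelE_succ (n + t), add_assoc j (t * i) i, ← Nat.succ_mul] at h
    exact ⟨_, h⟩

theorem swap_aux (n k : ℕ) : xq n + k • yq n = xq n + k • zq n := by
  induction k with
  | zero => simp
  | succ k ih =>
    rw [succ_nsmul, succ_nsmul, ← add_assoc, ih, add_right_comm, xq_yz, add_right_comm, add_assoc]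

theorem levelE_norm (n i j k : ℕ) (f : ℕ →₀ ℕ) (hi : i ≠ 0) :
    levelE n i j k f = levelE n i (j + k) 0 f := by
  obtain ⟨i, rfl⟩ := Nat.exists_eq_succ_of_ne_zero hi
  have := swap_aux n k
  simp only [levelE, Nat.succ_eq_add_one, add_nsmul, one_nsmul, zero_nsmul, add_zero]
  calc _ = i • xq n + j • yq n + (xq n + k • zq n) + aSum f := by abel
    _ = i • xq n + j • yq n + (xq n + k • yq n) + aSum f := by rw [this]
    _ = _ := by abel

theorem levelE_swap (n i j k j' k' : ℕ) (f : ℕ →₀ ℕ) (h : j + k = j' + k')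
    (h0 : i = 0 → j = j') : levelE n i j k f = levelE n i j' k' f := by
  by_cases hi : i = 0
  · have := h0 hi
    obtain rfl : j = j' := this
    obtain rfl : k = k' := by omega
    rfl
  · rw [levelE_norm _ _ _ _ _ hi, levelE_norm n i j' k' f hi, h]

theorem levelE_inv_x (n i j k i' j' k' : ℕ) (f f' : ℕ →₀ ℕ)
    (h : levelE n i j k f = levelE n i' j' k' f') : i = i' := by
  obtain ⟨F, hx, hy, hz, ha⟩ := MonM_lift (A := ℕ) (fun _ => 1) (fun _ => 0) (fun _ => 0)
    (fun _ => 0) rfl (fun _ => rfl) (fun _ => rfl) (fun _ => rfl) (fun _ => rfl)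
  have hS : ∀ f, F (aSum f) = 0 := by
    intro f
    have : F.comp aSum = 0 := by
      ext l
      simp [aSum, ha]
    exact DFunLike.congr_fun this f
  have := congrArg F h
  simpa [levelE, hx, hy, hz, hS] using this

theorem levelE_inv_yz (n i j k i' j' k' : ℕ) (f f' : ℕ →₀ ℕ)
    (h : levelE n i j k f = levelE n i' j' k' f') : j + k = j' + k' := by
  have hi := levelE_inv_x _ _ _ _ _ _ _ _ _ h
  subst hi
  obtain ⟨F, hx, hy, hz, ha⟩ := MonM_lift (A := ℤ) (fun l => -(l : ℤ)) (fun _ => 1) (fun _ => 1)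
    (fun _ => 0) rfl (fun _ => rfl) (fun _ => rfl) (fun _ => by push_cast; ring)
    (fun _ => by push_cast; ring)
  have hS : ∀ f, F (aSum f) = 0 := by
    intro f
    have : F.comp aSum = 0 := by
      ext l
      simp [aSum, ha]
    exact DFunLike.congr_fun this f
  have := congrArg F h
  simp [levelE, hx, hy, hz, hS] at this
  omega

theorem levelE_inv_a (n i j k i' j' k' : ℕ) (f f' : ℕ →₀ ℕ)
    (h : levelE n i j k f = levelE n i' j' k' f') : f = f' := by
  have hi := levelE_inv_x _ _ _ _ _ _ _ _ _ h
  have hjk := levelE_inv_yz _ _ _ _ _ _ _ _ _ h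
  subst hi
  ext m
  obtain ⟨F, hx, hy, hz, ha⟩ := MonM_lift (A := ℤ)
    (fun l => ∑ r ∈ Finset.range (l + 1), if m < r then 1 else 0)
    (fun l => if m < l then -1 else 0) (fun l => if m < l then -1 else 0)
    (fun l => if l = m then 1 else 0) rfl
    (fun l => by split_ifs <;> omega) (fun l => by split_ifs <;> omega)
    (fun l => by rw [Finset.sum_range_succ _ (l + 1)]; split_ifs <;> simp)
    (fun l => by rw [Finset.sum_range_succ _ (l + 1)]; split_ifs <;> simp)
  have hS : ∀ f, F (aSum f) = (f m : ℤ) := by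
    intro f
    have : F.comp aSum = (Nat.castAddMonoidHom ℤ).comp (Finsupp.applyAddHom m) := by
      ext l
      simp [aSum, ha, Finsupp.single_apply]
    exact DFunLike.congr_fun this f
  have h2 := congrArg F h
  simp only [levelE, map_add, map_nsmul, hx, hy, hz, hS, nsmul_eq_mul] at h2
  have h3 : (j : ℤ) + k = j' + k' := by exact_mod_cast hjk
  have h4 : (f m : ℤ) = f' m := by
    linear_combination h2 - (if m < n then (-1 : ℤ) else 0) * h3
  exact_mod_cast h4

theorem levelE_inv_y (n j k j' k' : ℕ) (f f' : ℕ →₀ ℕ)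
    (h : levelE n 0 j k f = levelE n 0 j' k' f') : j = j' := by
  obtain ⟨F, hx, hy, hz, ha⟩ := MonM_lift (A := ℕ∞) (fun _ => ⊤) (fun _ => 1) (fun _ => 0)
    (fun _ => 0) (by simp) (fun _ => by simp) (fun _ => by simp) (fun _ => by simp)
    (fun _ => by simp)
  have hS : ∀ f, F (aSum f) = 0 := by
    intro f
    have : F.comp aSum = 0 := by
      ext l
      simp [aSum, ha]
    exact DFunLike.congr_fun this f
  have := congrArg F h
  simpa [levelE, hy, hz, hS] using this

theorem exists_level (p : MonM) :
    ∃ N, ∀ n, N ≤ n → ∃ i j k f, p = levelE n i j k f := by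
  have up : ∀ n i j k f, ∀ n', n ≤ n' → ∃ i' j' k' f', levelE n i j k f = levelE n' i' j' k' f' := by
    intro n i j k f n' h
    obtain ⟨t, rfl⟩ := Nat.exists_eq_add_of_le h
    obtain ⟨f', hf⟩ := levelE_shift n t i j k f
    exact ⟨_, _, _, _, hf⟩
  have key : ∀ w : FreeMonM, ∃ N, ∀ n, N ≤ n → ∃ i j k f, MCon.mk' w = levelE n i j k f := by
    intro w
    induction w using Finsupp.induction_linear with
    | zero => exact ⟨0, fun n _ => ⟨0, 0, 0, 0, by simp [levelE]⟩⟩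
    | add u v hu hv =>
      obtain ⟨N, hN⟩ := hu
      obtain ⟨N', hN'⟩ := hv
      refine ⟨max N N', fun n hn => ?_⟩
      obtain ⟨i, j, k, f, h⟩ := hN n (le_trans (le_max_left _ _) hn)
      obtain ⟨i', j', k', f', h'⟩ := hN' n (le_trans (le_max_right _ _) hn)
      exact ⟨i + i', j + j', k + k', f + f', by rw [map_add, h, h', levelE_add]⟩
    | single s m =>
      have hs : (Finsupp.single s m : FreeMonM) = m • Finsupp.single s 1 := by simp
      rw [hs, map_nsmul]
      rcases s with ⟨c, l⟩ | l
      · refine ⟨l, fun n hn => ?_⟩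
        fin_cases c
        · have : m • MCon.mk' (Xg l) = levelE l m 0 0 0 := by simp [levelE, xq]
          obtain ⟨i, j, k, f, h⟩ := up l m 0 0 0 n hn
          exact ⟨i, j, k, f, this.trans h⟩
        · have : m • MCon.mk' (Yg l) = levelE l 0 m 0 0 := by simp [levelE, yq]
          obtain ⟨i, j, k, f, h⟩ := up l 0 m 0 0 n hn
          exact ⟨i, j, k, f, this.trans h⟩
        · have : m • MCon.mk' (Zg l) = levelE l 0 0 m 0 := by simp [levelE, zq]
          obtain ⟨i, j, k, f, h⟩ := up l 0 0 m 0 n hn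
          exact ⟨i, j, k, f, this.trans h⟩
      · refine ⟨0, fun n _ => ⟨0, 0, 0, Finsupp.single l m, ?_⟩⟩
        simp [levelE, aSum_single, aq, Ag]
  obtain ⟨w, rfl⟩ := AddCon.mk'_surjective (c := MCon) p
  exact key w

theorem refine_nat (a b c d : ℕ) (h : a + b = c + d) :
    ∃ p q r s : ℕ, a = p + q ∧ b = r + s ∧ c = p + r ∧ d = q + s :=
  ⟨min a c, a - c, c - a, b - (c - a), by omega, by omega, by omega, by omega⟩

theorem refine_fin (a b c d : ℕ →₀ ℕ) (h : a + b = c + d) :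
    ∃ p q r s : ℕ →₀ ℕ, a = p + q ∧ b = r + s ∧ c = p + r ∧ d = q + s := by
  have h' : ∀ m, a m + b m = c m + d m := fun m => DFunLike.congr_fun h m
  refine ⟨a ⊓ c, a - c, c - a, b - (c - a), ?_, ?_, ?_, ?_⟩ <;> ext m <;> have := h' m <;>
    simp only [Finsupp.add_apply, Finsupp.inf_apply, Finsupp.tsub_apply] <;> omega

theorem refine_level (n i1 i2 i3 i4 j1 j2 j3 j4 k1 k2 k3 k4 : ℕ) (f1 f2 f3 f4 : ℕ →₀ ℕ)
    (hi : i1 + i2 = i3 + i4) (hj : j1 + j2 = j3 + j4) (hk : k1 + k2 = k3 + k4)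
    (hf : f1 + f2 = f3 + f4) :
    ∃ z11 z12 z21 z22 : MonM,
      levelE n i1 j1 k1 f1 = z11 + z12 ∧ levelE n i2 j2 k2 f2 = z21 + z22 ∧
      levelE n i3 j3 k3 f3 = z11 + z21 ∧ levelE n i4 j4 k4 f4 = z12 + z22 := by
  obtain ⟨a, b, c, d, rfl, rfl, rfl, rfl⟩ := refine_nat _ _ _ _ hi
  obtain ⟨a', b', c', d', rfl, rfl, rfl, rfl⟩ := refine_nat _ _ _ _ hj
  obtain ⟨a'', b'', c'', d'', rfl, rfl, rfl, rfl⟩ := refine_nat _ _ _ _ hk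
  obtain ⟨p, q, r, s, rfl, rfl, rfl, rfl⟩ := refine_fin _ _ _ _ hf
  exact ⟨levelE n a a' a'' p, levelE n b b' b'' q, levelE n c c' c'' r, levelE n d d' d'' s,
    levelE_add .., levelE_add .., levelE_add .., levelE_add ..⟩

/-- Redistribution of the `y`'s and `z`'s on one side, once there is at least one `x`. -/
theorem redistribute (i1 i2 j1 j2 k1 k2 : ℕ) (hi : i1 + i2 ≠ 0) :
    ∃ c, c ≤ j1 + j2 ∧ ∀ d t, d ≤ t → ∃ J1 K1 J2 K2 : ℕ, J1 + J2 = c + d ∧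
      j1 + t * i1 + k1 = J1 + K1 ∧ j2 + t * i2 + k2 = J2 + K2 ∧
      (i1 = 0 → j1 + t * i1 = J1) ∧ (i2 = 0 → j2 + t * i2 = J2) := by
  by_cases h1 : i1 = 0
  · have h2 : i2 ≠ 0 := by omega
    refine ⟨j1, by omega, fun d t hd => ?_⟩
    have : t ≤ t * i2 := Nat.le_mul_of_pos_right _ (by omega)
    subst h1
    exact ⟨j1, k1, d, j2 + t * i2 + k2 - d, by omega, by omega, by omega, by omega, by omega⟩
  · by_cases h2 : i2 = 0
    · refine ⟨j2, by omega, fun d t hd => ?_⟩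
      have : t ≤ t * i1 := Nat.le_mul_of_pos_right _ (by omega)
      subst h2
      exact ⟨d, j1 + t * i1 + k1 - d, j2, k2, by omega, by omega, by omega, by omega, by omega⟩
    · refine ⟨0, by omega, fun d t hd => ?_⟩
      have : t ≤ t * i1 := Nat.le_mul_of_pos_right _ (by omega)
      exact ⟨d, j1 + t * i1 + k1 - d, 0, j2 + t * i2 + k2, by omega, by omega, by omega,
        by omega, by omega⟩

/-- The monoid `M` is a refinement monoid. -/
theorem MonM_refinement : IsRefinementAddMonoid MonM := by
  intro p1 p2 p3 p4 h
  obtain ⟨N1, h1⟩ := exists_level p1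
  obtain ⟨N2, h2⟩ := exists_level p2
  obtain ⟨N3, h3⟩ := exists_level p3
  obtain ⟨N4, h4⟩ := exists_level p4
  obtain ⟨n, hn⟩ : ∃ n, n = N1 + N2 + N3 + N4 := ⟨_, rfl⟩
  obtain ⟨i1, j1, k1, f1, rfl⟩ := h1 n (by omega)
  obtain ⟨i2, j2, k2, f2, rfl⟩ := h2 n (by omega)
  obtain ⟨i3, j3, k3, f3, rfl⟩ := h3 n (by omega)
  obtain ⟨i4, j4, k4, f4, rfl⟩ := h4 n (by omega)
  clear h1 h2 h3 h4
  have hs := h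
  rw [← levelE_add, ← levelE_add] at hs
  have hi := levelE_inv_x _ _ _ _ _ _ _ _ _ hs
  by_cases hi0 : i1 + i2 = 0
  · have hjk := levelE_inv_yz _ _ _ _ _ _ _ _ _ hs
    have hf := levelE_inv_a _ _ _ _ _ _ _ _ _ hs
    rw [← hi, hi0] at hs
    have hj := levelE_inv_y _ _ _ _ _ _ _ hs
    exact refine_level _ _ _ _ _ _ _ _ _ _ _ _ _ _ _ _ _ hi hj (by omega) hf
  · obtain ⟨c, hc, hC⟩ := redistribute i1 i2 j1 j2 k1 k2 hi0
    obtain ⟨d, hd, hD⟩ := redistribute i3 i4 j3 j4 k3 k4 (by omega)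
    obtain ⟨t, ht⟩ : ∃ t, t = j1 + j2 + j3 + j4 := ⟨_, rfl⟩
    obtain ⟨J1, K1, J2, K2, hJ, e1, e2, g1, g2⟩ := hC d t (by omega)
    obtain ⟨J3, K3, J4, K4, hJ', e3, e4, g3, g4⟩ := hD c t (by omega)
    obtain ⟨f1', w1⟩ := levelE_shift n t i1 j1 k1 f1
    obtain ⟨f2', w2⟩ := levelE_shift n t i2 j2 k2 f2
    obtain ⟨f3', w3⟩ := levelE_shift n t i3 j3 k3 f3
    obtain ⟨f4', w4⟩ := levelE_shift n t i4 j4 k4 f4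
    rw [levelE_swap _ _ _ _ _ _ _ e1 g1] at w1
    rw [levelE_swap _ _ _ _ _ _ _ e2 g2] at w2
    rw [levelE_swap _ _ _ _ _ _ _ e3 g3] at w3
    rw [levelE_swap _ _ _ _ _ _ _ e4 g4] at w4
    rw [w1, w2, w3, w4] at h ⊢
    rw [← levelE_add, ← levelE_add] at h
    have hjk := levelE_inv_yz _ _ _ _ _ _ _ _ _ h
    have hf := levelE_inv_a _ _ _ _ _ _ _ _ _ h
    exact refine_level _ _ _ _ _ _ _ _ _ _ _ _ _ _ _ _ _ hi (by omega) (by omega) hf
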